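/- arXiv:math/0508178 — 2 statements merged into one kernel-verified Lean document; each statement's English description precedes it below -/
import Mathlib

section
/- The adjugate of the characteristic matrix satisfies adj(λI + L) = Σ_{k=0}^{n−d} Q_k λ^{n−k−1}, i.e., the in-forest matrices Q_k are exactly the matrix coefficients in the polynomial expansion of adj(λI + L). -/
open Matrix Finset Polynomial

/-- `A` is (the arc set of) an in-forest of the weighted digraph with arc-weight
matrix `W`: all arcs are loopless arcs of positive weight, every vertex has
outdegree at most one, and there are no directed cycles. -/
def IsInForest {n : ℕ} (W : Matrix (Fin n) (Fin n) ℝ)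
    (A : Finset (Fin n × Fin n)) : Prop :=
  (∀ e ∈ A, e.1 ≠ e.2 ∧ 0 < W e.1 e.2) ∧
  (∀ i : Fin n, (A.filter (fun e => e.1 = i)).card ≤ 1) ∧
  (∀ i : Fin n, ¬ Relation.TransGen (fun a b => (a, b) ∈ A) i i)

/-- The weight of a forest: the product of its arc weights. -/
def forestWeight {n : ℕ} (W : Matrix (Fin n) (Fin n) ℝ)
    (A : Finset (Fin n × Fin n)) : ℝ :=
  ∏ e ∈ A, W e.1 e.2

/-- `i` belongs to the tree of the forest `A` converging to (rooted at) `j`. -/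
def InTreeRootedAt {n : ℕ} (A : Finset (Fin n × Fin n)) (i j : Fin n) : Prop :=
  Relation.ReflTransGen (fun a b => (a, b) ∈ A) i j ∧ ∀ e ∈ A, e.1 ≠ j

open scoped Classical in
/-- `σ_k`: the total weight of in-forests with `k` arcs. -/
noncomputable def sigmaW {n : ℕ} (W : Matrix (Fin n) (Fin n) ℝ) (k : ℕ) : ℝ :=
  ∑ A ∈ Finset.univ.powerset.filter
      (fun A => IsInForest W A ∧ A.card = k), forestWeight W A

open scoped Classical in
/-- `Q_k`: the matrix of in-forests with `k` arcs; its `(i,j)` entry is the total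
weight of in-forests with `k` arcs in which `i` belongs to a tree rooted at `j`. -/
noncomputable def forestMatrix {n : ℕ} (W : Matrix (Fin n) (Fin n) ℝ) (k : ℕ) :
    Matrix (Fin n) (Fin n) ℝ :=
  Matrix.of fun i j =>
    ∑ A ∈ Finset.univ.powerset.filter
        (fun A => IsInForest W A ∧ A.card = k ∧ InTreeRootedAt A i j),
      forestWeight W A

open scoped Classical in
/-- `σ`: the total weight of all in-forests. -/
noncomputable def sigmaTot {n : ℕ} (W : Matrix (Fin n) (Fin n) ℝ) : ℝ :=
  ∑ A ∈ Finset.univ.powerset.filter (fun A => IsInForest W A), forestWeight W A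

open scoped Classical in
/-- `Q`: the matrix of all in-forests. -/
noncomputable def forestMatrixTot {n : ℕ} (W : Matrix (Fin n) (Fin n) ℝ) :
    Matrix (Fin n) (Fin n) ℝ :=
  Matrix.of fun i j =>
    ∑ A ∈ Finset.univ.powerset.filter
        (fun A => IsInForest W A ∧ InTreeRootedAt A i j), forestWeight W A

open scoped Classical in
/-- The number of arcs in a maximum in-forest (equal to `n - d` where `d` is the
in-forest dimension). -/
noncomputable def maxForestCard {n : ℕ} (W : Matrix (Fin n) (Fin n) ℝ) : ℕ :=
  (Finset.univ.powerset.filter (fun A => IsInForest W A)).sup Finset.card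

/-- The in-forest dimension `d` of the digraph. -/
noncomputable def forestDim {n : ℕ} (W : Matrix (Fin n) (Fin n) ℝ) : ℕ :=
  n - maxForestCard W

/-- The (row) Laplacian matrix of the weighted digraph with arc-weight matrix `W`. -/
def lap {n : ℕ} (W : Matrix (Fin n) (Fin n) ℝ) : Matrix (Fin n) (Fin n) ℝ :=
  Matrix.diagonal (fun i => ∑ j, W i j) - W

/-- `J̃`: the normalized matrix of maximum in-forests. -/
noncomputable def Jtilde {n : ℕ} (W : Matrix (Fin n) (Fin n) ℝ) :
    Matrix (Fin n) (Fin n) ℝ :=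
  (sigmaW W (maxForestCard W))⁻¹ • forestMatrix W (maxForestCard W)

section PartialMap

variable {V : Type*} [Fintype V] [DecidableEq V]

/-- The matrix `1 - P`, where `P` is the transition matrix of the partial self-map `f`. -/
def partialMapMatrix (R : Type*) [CommRing R] (f : V → Option V) : Matrix V V R :=
  Matrix.of fun r => Pi.single r 1 - (f r).elim 0 fun s => Pi.single s 1

/-- The contribution of the vertex `r` to the weight of a partial self-map rooted at `j`: `W r s`
for an arc `r → s` and `x` when `r` has no outgoing arc, except that the root `j` contributes `1`
and may not have an outgoing arc. -/
def arcWeight {R : Type*} [CommRing R] (W : Matrix V V R) (x : R) (j r : V) : Option V → R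
  | none => if r = j then 1 else x
  | some s => if r = j then 0 else W r s

/-- The set of arcs `r → s` of a partial self-map. -/
def arcSet (f : V → Option V) : Finset (V × V) :=
  Finset.univ.filter fun e => f e.1 = some e.2

@[simp]
lemma mem_arcSet {f : V → Option V} {e : V × V} : e ∈ arcSet f ↔ f e.1 = some e.2 := by
  simp [arcSet]

lemma arcSet_injective : Function.Injective (arcSet : (V → Option V) → Finset (V × V)) := by
  intro f g h
  funext r
  ext s
  have := congrArg (fun A => (r, s) ∈ A) h
  simpa using this

lemma exists_arcSet_eq {A : Finset (V × V)}
    (hA : ∀ i, (A.filter fun e => e.1 = i).card ≤ 1) : ∃ f, arcSet f = A := by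
  classical
  refine ⟨fun r => if h : ∃ s, (r, s) ∈ A then some h.choose else none, ?_⟩
  ext ⟨r, s⟩
  rw [mem_arcSet]
  constructor
  · intro h
    dsimp only at h
    split_ifs at h with h'
    simpa [← Option.some.inj h] using h'.choose_spec
  · intro h
    have h' : ∃ s, (r, s) ∈ A := ⟨s, h⟩
    have := Finset.card_le_one.1 (hA r) (r, h'.choose) (by simpa using h'.choose_spec)
      (r, s) (by simpa using h)
    simpa [dif_pos h'] using this

lemma card_filter_arcSet_le_one (f : V → Option V) (i : V) :
    ((arcSet f).filter fun e => e.1 = i).card ≤ 1 := by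
  rw [Finset.card_le_one]
  rintro ⟨a, b⟩ h ⟨c, d⟩ h'
  simp only [Finset.mem_filter, mem_arcSet] at h h'
  obtain ⟨h, rfl⟩ := h
  obtain ⟨h', rfl⟩ := h'
  simpa [h] using h'

lemma prod_arcSet {M : Type*} [CommMonoid M] (f : V → Option V) (g : V → V → M) :
    ∏ e ∈ arcSet f, g e.1 e.2 = ∏ r, (f r).elim 1 (g r) := by
  rw [arcSet, Finset.prod_filter, Fintype.prod_prod_type]
  refine Finset.prod_congr rfl fun r _ => ?_
  cases h : f r <;> simp [h]

lemma prod_arcWeight {R : Type*} [CommRing R] (W : Matrix V V R) (x : R) {j : V}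
    {f : V → Option V} (hj : f j = none) :
    ∏ r, arcWeight W x j r (f r) =
      x ^ (Fintype.card V - (arcSet f).card - 1) * ∏ e ∈ arcSet f, W e.1 e.2 := by
  have hcard : (arcSet f).card + (Finset.univ.filter fun r => f r = none ∧ r ≠ j).card + 1 =
      Fintype.card V := by
    have h₁ : (arcSet f).card = (Finset.univ.filter fun r => f r ≠ none).card := by
      refine Finset.card_nbij Prod.fst ?_ ?_ ?_
      · rintro ⟨r, s⟩ h
        simp_all
      · rintro ⟨r, s⟩ h ⟨r', s'⟩ h' e
        simp only [Finset.mem_coe, mem_arcSet] at h h' e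
        subst e
        simpa [h] using h'
      · intro r h
        obtain ⟨s, hs⟩ := Option.ne_none_iff_exists'.1 (by simpa using h)
        exact ⟨(r, s), by simpa using hs, rfl⟩
    have h₂ : (Finset.univ.filter fun r => f r = none ∧ r ≠ j) =
        (Finset.univ.filter fun r => f r = none).erase j := by
      ext r
      simp [and_comm]
    rw [h₁, h₂, add_assoc, Finset.card_erase_add_one (by simpa using hj), add_comm,
      Finset.card_filter_add_card_filter_not, Finset.card_univ]
  have hexp : Fintype.card V - (arcSet f).card - 1 =
      (Finset.univ.filter fun r => f r = none ∧ r ≠ j).card := by omega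
  rw [prod_arcSet f fun r s => W r s, hexp, ← Finset.prod_const, Finset.prod_filter, ← Finset.prod_mul_distrib]
  refine Finset.prod_congr rfl fun r _ => ?_
  rcases eq_or_ne r j with rfl | hr
  · simp [hj, arcWeight]
  · cases f r <;> simp [arcWeight, hr]

lemma prod_arcWeight_eq_zero {R : Type*} [CommRing R] (W : Matrix V V R) (x : R) {j : V}
    {f : V → Option V} (hj : f j ≠ none) : ∏ r, arcWeight W x j r (f r) = 0 := by
  obtain ⟨s, hs⟩ := Option.ne_none_iff_exists'.1 hj
  exact Finset.prod_eq_zero (Finset.mem_univ j) (by simp [hs, arcWeight])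

lemma det_partialMapMatrix_of_acyclic (R : Type*) [CommRing R] {f : V → Option V}
    (hf : ∀ i, ¬ Relation.TransGen (fun a b => f a = some b) i i) :
    (partialMapMatrix R f).det = 1 := by
  classical
  let b : V → ℕ := fun i =>
    (Finset.univ.filter fun s => Relation.TransGen (fun a b => f a = some b) s i).card
  have hb : ∀ r s, f r = some s → b r < b s := by
    intro r s h
    refine Finset.card_lt_card ⟨fun t ht => ?_, fun hsub => hf r ?_⟩
    · simp only [Finset.mem_filter, Finset.mem_univ, true_and] at ht ⊢
      exact ht.tail h
    · simpa using hsub (Finset.mem_filter.2 ⟨Finset.mem_univ r, .single h⟩)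
  have hentry : ∀ r s, r ≠ s → b s ≤ b r → partialMapMatrix R f r s = 0 := by
    intro r s hrs hle
    cases h : f r with
    | none => simp [partialMapMatrix, h, hrs.symm]
    | some t =>
      have hts : s ≠ t := by
        rintro rfl
        exact absurd (hb r s h) (by omega)
      simp [partialMapMatrix, h, hrs.symm, hts]
  have htri : (partialMapMatrix R f).BlockTriangular b := fun r s hlt =>
    hentry r s (by rintro rfl; exact lt_irrefl _ hlt) hlt.le
  rw [htri.det]
  refine Finset.prod_eq_one fun a _ => ?_
  suffices h : (partialMapMatrix R f).toSquareBlock b a = 1 by rw [h, Matrix.det_one]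
  ext ⟨r, hr⟩ ⟨s, hs⟩
  rw [Matrix.toSquareBlock_def, Matrix.of_apply]
  by_cases hrs : r = s
  · subst hrs
    cases h : f r with
    | none => simp [partialMapMatrix, h]
    | some t =>
      have hts : r ≠ t := by
        rintro rfl
        exact hf r (.single h)
      simp [partialMapMatrix, h, hts]
  · rw [Matrix.one_apply_ne (by simpa using hrs), hentry r s hrs (hs.trans hr.symm).le]

open scoped Classical in
lemma adjugate_partialMapMatrix_of_acyclic (R : Type*) [CommRing R] {f : V → Option V}
    (hf : ∀ i, ¬ Relation.TransGen (fun a b => f a = some b) i i) {j : V} (hj : f j = none)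
    (i : V) :
    (partialMapMatrix R f).adjugate i j =
      if Relation.ReflTransGen (fun a b => f a = some b) i j then 1 else 0 := by
  let v : V → R := fun i =>
    if Relation.ReflTransGen (fun a b => f a = some b) i j then 1 else 0
  have hv : partialMapMatrix R f *ᵥ v = Pi.single j 1 := by
    funext r
    have hrow : (partialMapMatrix R f *ᵥ v) r = v r - (f r).elim 0 v := by
      change (Pi.single r 1 - (f r).elim 0 fun s => Pi.single s 1) ⬝ᵥ v = _
      rw [sub_dotProduct]
      cases f r <;> simp
    rw [hrow]
    rcases eq_or_ne r j with rfl | hr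
    · simp [hj, v, Relation.ReflTransGen.refl]
    · rw [Pi.single_eq_of_ne hr]
      have hiff : Relation.ReflTransGen (fun a b => f a = some b) r j ↔
          ∃ s, f r = some s ∧ Relation.ReflTransGen (fun a b => f a = some b) s j := by
        rw [Relation.ReflTransGen.cases_head_iff]
        simp [hr]
      cases h : f r with
      | none => simp [v, hiff, h]
      | some s => simp [v, hiff, h]
  have hadj : (partialMapMatrix R f).adjugate *ᵥ Pi.single j 1 = v := by
    rw [← hv, Matrix.mulVec_mulVec, Matrix.adjugate_mul, det_partialMapMatrix_of_acyclic R hf,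
      one_smul, Matrix.one_mulVec]
  simpa using congrFun hadj i

lemma adjugate_partialMapMatrix_of_cyclic (R : Type*) [CommRing R] [IsDomain R]
    {f : V → Option V} {v : V} (hv : Relation.TransGen (fun a b => f a = some b) v v) {j : V}
    (hj : f j = none) (i : V) :
    (partialMapMatrix R f).adjugate i j = 0 := by
  classical
  let C : Finset V := Finset.univ.filter fun s =>
    Relation.TransGen (fun a b => f a = some b) v s ∧
      Relation.TransGen (fun a b => f a = some b) s v
  have hmem : ∀ {s}, s ∈ C ↔ Relation.TransGen (fun a b => f a = some b) v s ∧
      Relation.TransGen (fun a b => f a = some b) s v := by simp [C]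
  have hvC : v ∈ C := hmem.2 ⟨hv, hv⟩
  have hjC : j ∉ C := fun h => by
    obtain ⟨t, ht, -⟩ := Relation.TransGen.head'_iff.1 (hmem.1 h).2
    simp [hj] at ht
  let g : V → V := fun r => (f r).getD r
  have hg : ∀ r ∈ C, f r = some (g r) ∧ g r ∈ C := by
    intro r hr
    obtain ⟨hvr, hrv⟩ := hmem.1 hr
    obtain ⟨t, ht, htv⟩ := Relation.TransGen.head'_iff.1 hrv
    have hgt : g r = t := by simp [g, ht]
    rw [hgt]
    refine ⟨ht, hmem.2 ⟨hvr.tail ht, ?_⟩⟩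
    exact Relation.TransGen.trans_right htv hv
  have hsurj : Set.SurjOn g C C := by
    intro s hs
    obtain ⟨hvs, hsv⟩ := hmem.1 hs
    obtain ⟨t, hvt, hts⟩ := Relation.TransGen.tail'_iff.1 hvs
    exact ⟨t, hmem.2 ⟨hv.trans_left hvt, hsv.head hts⟩, by simp [g, hts]⟩
  have hmaps : Set.MapsTo g C C := fun r hr => (hg r hr).2
  have hinj : Set.InjOn g C := Finset.injOn_of_surjOn_of_card_le g hmaps hsurj le_rfl
  rw [Matrix.adjugate_apply, ← Matrix.exists_vecMul_eq_zero_iff]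
  refine ⟨fun r => if r ∈ C then 1 else 0, fun h => by simpa [hvC] using congrFun h v, ?_⟩
  funext t
  have hrow : ∀ r ∈ C, (partialMapMatrix R f).updateRow j (Pi.single i 1) r t =
      (Pi.single r 1 : V → R) t - (Pi.single (g r) 1 : V → R) t := by
    intro r hr
    rw [Matrix.updateRow_ne (by rintro rfl; exact hjC hr)]
    simp [partialMapMatrix, (hg r hr).1]
  simp only [Matrix.vecMul, dotProduct, ite_mul, one_mul, zero_mul, Finset.sum_ite_mem,
    Finset.univ_inter, Pi.zero_apply]
  rw [Finset.sum_congr rfl hrow, Finset.sum_sub_distrib, sub_eq_zero]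
  exact (Finset.sum_nbij g hmaps hinj hsurj fun r _ => rfl).symm

/-- Multilinear expansion of the adjugate of `x • 1 + L` along the rows. -/
lemma adjugate_smul_one_add_eq_sum {R : Type*} [CommRing R] (W : Matrix V V R) (x : R) (i j : V) :
    (x • (1 : Matrix V V R) + (Matrix.diagonal (fun i => ∑ j, W i j) - W)).adjugate i j =
      ∑ f : V → Option V,
        (∏ r, arcWeight W x j r (f r)) * (partialMapMatrix R f).adjugate i j := by
  let row : V → Option V → V → R := fun r o =>
    if r = j then Pi.single i 1 else Pi.single r 1 - o.elim 0 fun s => Pi.single s 1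
  have hM : (x • (1 : Matrix V V R) + (Matrix.diagonal (fun i => ∑ j, W i j) - W)).updateRow j
      (Pi.single i 1) = Matrix.of fun r => ∑ o, arcWeight W x j r o • row r o := by
    ext r t
    rw [Matrix.of_apply, Fintype.sum_option]
    rcases eq_or_ne r j with rfl | hr
    · simp [arcWeight, row]
    · rw [Matrix.updateRow_ne hr]
      rcases eq_or_ne r t with rfl | hrt
      · simp [arcWeight, row, hr, Finset.sum_apply, Pi.single_apply, mul_sub]
      · simp [arcWeight, row, hr, hrt, hrt.symm, Finset.sum_apply, Pi.single_apply]
  have hB : ∀ f : V → Option V, (partialMapMatrix R f).updateRow j (Pi.single i 1) =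
      Matrix.of fun r => row r (f r) := by
    intro f
    ext r t
    rcases eq_or_ne r j with rfl | hr
    · simp [row]
    · simp [row, hr, partialMapMatrix]
  simp only [Matrix.adjugate_apply, hM, hB]
  refine ((Matrix.detRowAlternating (R := R) (n := V)).toMultilinearMap.map_sum
    fun r o => arcWeight W x j r o • row r o).trans ?_
  refine Finset.sum_congr rfl fun f _ => ?_
  exact (Matrix.detRowAlternating (R := R) (n := V)).toMultilinearMap.map_smul_univ
    (fun r => arcWeight W x j r (f r)) fun r => row r (f r)

end PartialMap

open scoped Classical in
lemma sum_smul_forestMatrix_apply {n : ℕ} (W : Matrix (Fin n) (Fin n) ℝ) (x : ℝ) (i j : Fin n) :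
    (∑ k ∈ Finset.range (maxForestCard W + 1), x ^ (n - k - 1) • forestMatrix W k) i j =
      ∑ A ∈ Finset.univ.filter fun A => IsInForest W A ∧ InTreeRootedAt A i j,
        x ^ (n - A.card - 1) * forestWeight W A := by
  rw [Matrix.sum_apply, ← Finset.sum_fiberwise_of_maps_to (g := Finset.card)
    (t := Finset.range (maxForestCard W + 1))]
  · refine Finset.sum_congr rfl fun k _ => ?_
    rw [Matrix.smul_apply, forestMatrix, Matrix.of_apply, smul_eq_mul, Finset.mul_sum,
      Finset.filter_filter, Finset.powerset_univ]
    refine Finset.sum_congr (Finset.filter_congr fun A _ => by tauto) fun A hA => ?_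
    rw [(Finset.mem_filter.1 hA).2.2]
  · intro A hA
    rw [Finset.mem_range, Nat.lt_succ_iff]
    refine Finset.le_sup (f := Finset.card) ?_
    simpa using (Finset.mem_filter.1 hA).2.1

/-- `adj(λI + L) = Σ_{k=0}^{n-d} Q_k λ^{n-k-1}`: the in-forest matrices are the
matrix coefficients of the polynomial expansion of the adjugate of the
characteristic matrix. -/
theorem adjugate_charMatrix_eq_sum_forestMatrix {n : ℕ}
    (W : Matrix (Fin n) (Fin n) ℝ)
    (hn : 1 < n) (hW : ∀ i j, 0 ≤ W i j) (hdiag : ∀ i, W i i = 0) :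
    ∀ lam : ℝ,
      (lam • (1 : Matrix (Fin n) (Fin n) ℝ) + lap W).adjugate =
        ∑ k ∈ Finset.range (maxForestCard W + 1),
          lam ^ (n - k - 1) • forestMatrix W k := by
  classical
  intro lam
  ext i j
  rw [sum_smul_forestMatrix_apply, lap, adjugate_smul_one_add_eq_sum]
  have hadj : ∀ f : Fin n → Option (Fin n),
      (∏ r, arcWeight W lam j r (f r)) * (partialMapMatrix ℝ f).adjugate i j =
        if IsInForest W (arcSet f) ∧ InTreeRootedAt (arcSet f) i j then
          lam ^ (n - (arcSet f).card - 1) * forestWeight W (arcSet f) else 0 := by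
    intro f
    by_cases hj : f j = none
    · rw [prod_arcWeight W lam hj, Fintype.card_fin, ← forestWeight]
      by_cases hf : ∀ i, ¬ Relation.TransGen (fun a b => f a = some b) i i
      · rw [adjugate_partialMapMatrix_of_acyclic ℝ hf hj]
        have hroot : InTreeRootedAt (arcSet f) i j ↔
            Relation.ReflTransGen (fun a b => f a = some b) i j := by
          simp only [InTreeRootedAt, mem_arcSet, and_iff_left_iff_imp]
          rintro - ⟨r, s⟩ hrs rfl
          simp [hj] at hrs
        by_cases hpos : ∀ e ∈ arcSet f, 0 < W e.1 e.2
        · have hforest : IsInForest W (arcSet f) := by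
            refine ⟨fun e he => ⟨fun h => ?_, hpos e he⟩, card_filter_arcSet_le_one f, ?_⟩
            · have := hpos e he
              rw [h, hdiag] at this
              exact lt_irrefl _ this
            · simpa only [mem_arcSet] using hf
          simp [hforest, hroot]
        · push Not at hpos
          obtain ⟨e, he, hle⟩ := hpos
          have hzero : forestWeight W (arcSet f) = 0 :=
            Finset.prod_eq_zero he (le_antisymm hle (hW _ _))
          simp [hzero]
      · push Not at hf
        obtain ⟨v, hv⟩ := hf
        rw [adjugate_partialMapMatrix_of_cyclic ℝ hv hj, mul_zero, if_neg]
        rintro ⟨⟨-, -, hacyc⟩, -⟩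
        exact hacyc v (by simpa only [mem_arcSet] using hv)
    · rw [prod_arcWeight_eq_zero W lam hj, zero_mul, if_neg]
      rintro ⟨-, -, hroot⟩
      obtain ⟨s, hs⟩ := Option.ne_none_iff_exists'.1 hj
      exact hroot (j, s) (by simpa using hs) rfl
  rw [Finset.sum_congr rfl fun f _ => hadj f, ← Finset.sum_filter]
  refine Finset.sum_nbij arcSet (fun f hf => ?_) arcSet_injective.injOn (fun A hA => ?_)
    fun f _ => rfl
  · simpa using hf
  · obtain ⟨hA, hroot⟩ := (Finset.mem_filter.1 hA).2
    obtain ⟨f, rfl⟩ := exists_arcSet_eq hA.2.1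
    exact ⟨f, by simp [hA, hroot], rfl⟩
end

section
/- rank J̃ = tr J̃ = d, the multiplicity of the eigenvalue 1 of J̃ is d, and the multiplicity of the eigenvalue 0 of J̃ is n−d. -/
open Matrix Finset Polynomial

/-- The arc set `A` has outdegrees at most one and no directed cycles. -/
def IsFunctionalForest {n : ℕ} (A : Finset (Fin n × Fin n)) : Prop :=
  (∀ a b c : Fin n, (a, b) ∈ A → (a, c) ∈ A → b = c) ∧
  ∀ i : Fin n, ¬ Relation.TransGen (fun a b => (a, b) ∈ A) i i

theorem isInForest_iff {n : ℕ} {W : Matrix (Fin n) (Fin n) ℝ} {A : Finset (Fin n × Fin n)} :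
    IsInForest W A ↔ IsFunctionalForest A ∧ ∀ e ∈ A, 0 < W e.1 e.2 := by
  constructor
  · rintro ⟨h1, h2, h3⟩
    refine ⟨⟨fun a b c hb hc => ?_, h3⟩, fun e he => (h1 e he).2⟩
    have := Finset.card_le_one.1 (h2 a) (a, b) (by simp [hb]) (a, c) (by simp [hc])
    exact (Prod.mk.inj this).2
  · rintro ⟨⟨h1, h2⟩, h3⟩
    refine ⟨fun e he => ⟨fun h => h2 e.1 (.single ?_), h3 e he⟩, fun i => ?_, h2⟩
    · show (e.1, e.1) ∈ A
      have : (e.1, e.1) = e := Prod.ext rfl h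
      rwa [this]
    · refine Finset.card_le_one.2 ?_
      rintro ⟨a, b⟩ hb ⟨a', c⟩ hc
      simp only [Finset.mem_filter] at hb hc
      obtain ⟨hb, rfl⟩ := hb
      obtain ⟨hc, rfl⟩ := hc
      rw [h1 _ _ _ hb hc]

theorem isInForest_empty {n : ℕ} (W : Matrix (Fin n) (Fin n) ℝ) : IsInForest W ∅ := by
  refine ⟨by simp, by simp, fun i h => ?_⟩
  obtain ⟨_, h, -⟩ := Relation.TransGen.head'_iff.1 h
  simp at h

section Reachability

variable {n : ℕ} {A : Finset (Fin n × Fin n)}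

theorem InTreeRootedAt.unique (hA : IsFunctionalForest A) {v i j : Fin n}
    (hi : InTreeRootedAt A v i) (hj : InTreeRootedAt A v j) : i = j := by
  obtain ⟨hi, hi'⟩ := hi
  obtain ⟨hj, hj'⟩ := hj
  induction hi using Relation.ReflTransGen.head_induction_on with
  | refl =>
    rcases Relation.ReflTransGen.cases_head hj with h | ⟨c, hc, -⟩
    · exact h
    · exact absurd rfl (hi' _ hc)
  | head hac _ ih =>
    rcases Relation.ReflTransGen.cases_head hj with rfl | ⟨d, hd, hdj⟩
    · exact absurd rfl (hj' _ hac)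
    · rw [hA.1 _ _ _ hac hd] at ih
      exact ih hdj

/-- A path in `A` with the extra arc `(i, m)` either avoids the extra arc or uses it once, provided
that `m` does not reach `i` in `A`. -/
theorem reach_insert {i m : Fin n}
    (hm : ¬ Relation.ReflTransGen (fun a b => (a, b) ∈ A) m i) {a b : Fin n}
    (h : Relation.ReflTransGen (fun a b => (a, b) ∈ insert (i, m) A) a b) :
    Relation.ReflTransGen (fun a b => (a, b) ∈ A) a b ∨
      Relation.ReflTransGen (fun a b => (a, b) ∈ A) a i ∧
        Relation.ReflTransGen (fun a b => (a, b) ∈ A) m b := by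
  induction h using Relation.ReflTransGen.head_induction_on with
  | refl => exact .inl .refl
  | head hac _ ih =>
    rcases Finset.mem_insert.1 hac with h | h
    · obtain ⟨rfl, rfl⟩ := Prod.mk.inj h
      rcases ih with ih | ih
      · exact .inr ⟨.refl, ih⟩
      · exact absurd ih.1 hm
    · rcases ih with ih | ih
      · exact .inl (.head h ih)
      · exact .inr ⟨.head h ih.1, ih.2⟩

theorem IsFunctionalForest.insert (hA : IsFunctionalForest A) {i m : Fin n}
    (hi : ∀ e ∈ A, e.1 ≠ i) (hm : ¬ InTreeRootedAt A m i) :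
    IsFunctionalForest (insert (i, m) A) := by
  have hm' : ¬ Relation.ReflTransGen (fun a b => (a, b) ∈ A) m i := fun h => hm ⟨h, hi⟩
  constructor
  · intro a b c hb hc
    rcases Finset.mem_insert.1 hb with hb | hb <;> rcases Finset.mem_insert.1 hc with hc | hc
    · exact (Prod.mk.inj hb).2.trans (Prod.mk.inj hc).2.symm
    · exact absurd (Prod.mk.inj hb).1 (hi _ hc)
    · exact absurd (Prod.mk.inj hc).1 (hi _ hb)
    · exact hA.1 _ _ _ hb hc
  · intro x hx
    obtain ⟨c, hxc, hcx⟩ := Relation.TransGen.head'_iff.1 hx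
    rcases Finset.mem_insert.1 hxc with h | h
    · obtain ⟨rfl, rfl⟩ := Prod.mk.inj h
      rcases reach_insert hm' hcx with h | h
      · exact hm' h
      · exact hm' h.1
    · rcases reach_insert hm' hcx with h' | h'
      · exact hA.2 x (.head' h h')
      · exact hm' (h'.2.trans (.head h h'.1))

theorem inTreeRootedAt_insert (hA : IsFunctionalForest A) {i m : Fin n}
    (hi : ∀ e ∈ A, e.1 ≠ i) (hm : ¬ InTreeRootedAt A m i) (v j : Fin n) :
    InTreeRootedAt (insert (i, m) A) v j ↔
      InTreeRootedAt A v i ∧ InTreeRootedAt A m j ∨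
        ¬ InTreeRootedAt A v i ∧ InTreeRootedAt A v j := by
  have hm' : ¬ Relation.ReflTransGen (fun a b => (a, b) ∈ A) m i := fun h => hm ⟨h, hi⟩
  have mono : ∀ {a b}, Relation.ReflTransGen (fun a b => (a, b) ∈ A) a b →
      Relation.ReflTransGen (fun a b => (a, b) ∈ insert (i, m) A) a b :=
    fun h => Relation.ReflTransGen.mono (fun _ _ h => Finset.mem_insert_of_mem h) _ _ h
  have root : ∀ {j}, j ≠ i → (∀ e ∈ A, e.1 ≠ j) → ∀ e ∈ insert (i, m) A, e.1 ≠ j := by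
    intro j hji hj e he
    rcases Finset.mem_insert.1 he with rfl | he
    · exact hji.symm
    · exact hj e he
  constructor
  · rintro ⟨h, hj⟩
    have hj' : ∀ e ∈ A, e.1 ≠ j := fun e he => hj e (Finset.mem_insert_of_mem he)
    have hij : i ≠ j := hj _ (Finset.mem_insert_self _ _)
    rcases reach_insert hm' h with h | h
    · exact .inr ⟨fun h' => hij (h'.unique hA ⟨h, hj'⟩), h, hj'⟩
    · exact .inl ⟨⟨h.1, hi⟩, h.2, hj'⟩
  · rintro (⟨hv, hmj⟩ | ⟨hv, hvj⟩)
    · exact ⟨(mono hv.1).trans (.head (Finset.mem_insert_self _ _) (mono hmj.1)),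
        root (by rintro rfl; exact hm hmj) hmj.2⟩
    · exact ⟨mono hvj.1, root (by rintro rfl; exact hv hvj) hvj.2⟩

theorem IsFunctionalForest.erase (hA : IsFunctionalForest A) {i m : Fin n} (h : (i, m) ∈ A) :
    IsFunctionalForest (A.erase (i, m)) ∧ (∀ e ∈ A.erase (i, m), e.1 ≠ i) ∧
      ¬ InTreeRootedAt (A.erase (i, m)) m i := by
  refine ⟨⟨fun a b c hb hc => hA.1 a b c (Finset.mem_of_mem_erase hb)
    (Finset.mem_of_mem_erase hc), fun x hx => hA.2 x
      (Relation.TransGen.mono (fun _ _ h => Finset.mem_of_mem_erase h) _ _ hx)⟩, ?_, fun hm => hA.2 i ?_⟩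
  · rintro ⟨a, b⟩ hab rfl
    obtain ⟨hne, hab⟩ := Finset.mem_erase.1 hab
    exact hne (by rw [hA.1 _ _ _ hab h])
  · exact .head' h (Relation.ReflTransGen.mono (fun _ _ h => Finset.mem_of_mem_erase h) _ _ hm.1)

end Reachability

open scoped Classical in
/-- Summing over forests by first deleting the arc that leaves `i`, if there is one. -/
theorem sum_forests_eq {n : ℕ} (i : Fin n) (g : Finset (Fin n × Fin n) → ℝ) :
    ∑ A with IsFunctionalForest A, g A =
      ∑ A with IsFunctionalForest A ∧ ∀ e ∈ A, e.1 ≠ i,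
        (g A + ∑ m with ¬ InTreeRootedAt A m i, g (insert (i, m) A)) := by
  rw [Finset.sum_add_distrib, ← Finset.sum_filter_add_sum_filter_not
    (Finset.univ.filter IsFunctionalForest) (fun A => ∀ e ∈ A, e.1 ≠ i), Finset.filter_filter,
    Finset.filter_filter, Finset.sum_sigma']
  congr 1
  symm
  refine Finset.sum_bij (fun p _ => insert (i, p.2) p.1) ?_ ?_ ?_ (fun _ _ => rfl)
  · rintro ⟨A, m⟩ h
    simp only [Finset.mem_sigma, Finset.mem_filter, Finset.mem_univ, true_and] at h ⊢
    exact ⟨h.1.1.insert h.1.2 h.2, fun h' => h' _ (Finset.mem_insert_self _ _) rfl⟩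
  · rintro ⟨A, m⟩ h ⟨B, m'⟩ h' heq
    simp only [Finset.mem_sigma, Finset.mem_filter, Finset.mem_univ, true_and] at h h' heq
    have hA : (i, m) ∉ A := fun hh => h.1.2 _ hh rfl
    have hB : (i, m') ∉ B := fun hh => h'.1.2 _ hh rfl
    have hmm : m = m' := by
      have : (i, m) ∈ insert (i, m') B := heq ▸ Finset.mem_insert_self _ _
      rcases Finset.mem_insert.1 this with h1 | h1
      · exact (Prod.mk.inj h1).2
      · exact absurd rfl (h'.1.2 _ h1)
    subst hmm
    have : A = B := by rw [← Finset.erase_insert hA, heq, Finset.erase_insert hB]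
    rw [this]
  · intro A hA
    simp only [Finset.mem_filter, Finset.mem_univ, true_and] at hA
    obtain ⟨hA, hi⟩ := hA
    push Not at hi
    obtain ⟨⟨a, m⟩, hm, rfl⟩ := hi
    have := hA.erase hm
    exact ⟨⟨A.erase (a, m), m⟩, by simpa [and_assoc] using this, Finset.insert_erase hm⟩

section Weights

variable {n : ℕ} {W : Matrix (Fin n) (Fin n) ℝ}

open scoped Classical in
theorem sum_isInForest_eq (hW : ∀ i j, 0 ≤ W i j) (k : ℕ) (P : Finset (Fin n × Fin n) → Prop) :
    ∑ A with IsInForest W A ∧ A.card = k ∧ P A, forestWeight W A =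
      ∑ A with IsFunctionalForest A,
        (if A.card = k then forestWeight W A else 0) * (if P A then 1 else 0) := by
  have : ∀ A : Finset (Fin n × Fin n), (if A.card = k then forestWeight W A else 0) *
      (if P A then 1 else 0) = if A.card = k ∧ P A then forestWeight W A else 0 := by
    intro A
    by_cases h : A.card = k <;> by_cases h' : P A <;> simp [h, h']
  simp_rw [this]
  rw [← Finset.sum_filter, Finset.filter_filter]
  refine Finset.sum_subset (fun A hA => ?_) (fun A hA hA' => ?_)
  · simp only [Finset.mem_filter, Finset.mem_univ, true_and, isInForest_iff] at hA ⊢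
    exact ⟨hA.1.1, hA.2⟩
  · simp only [Finset.mem_filter, Finset.mem_univ, true_and, isInForest_iff] at hA hA'
    have : ∃ e ∈ A, W e.1 e.2 ≤ 0 := by
      by_contra! hcon
      exact hA' ⟨⟨hA.1, hcon⟩, hA.2⟩
    obtain ⟨e, he, hle⟩ := this
    exact Finset.prod_eq_zero he (le_antisymm hle (hW _ _))

open scoped Classical in
theorem forestMatrix_apply_eq (hW : ∀ i j, 0 ≤ W i j) (k : ℕ) (i j : Fin n) :
    forestMatrix W k i j = ∑ A with IsFunctionalForest A,
      (if A.card = k then forestWeight W A else 0) * (if InTreeRootedAt A i j then 1 else 0) := by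
  rw [← sum_isInForest_eq hW k (fun A => InTreeRootedAt A i j)]
  simp [forestMatrix]

open scoped Classical in
theorem sigmaW_eq (hW : ∀ i j, 0 ≤ W i j) (k : ℕ) :
    sigmaW W k = ∑ A with IsFunctionalForest A,
      (if A.card = k then forestWeight W A else 0) := by
  have := sum_isInForest_eq hW k (fun _ => True)
  simp only [and_true, if_true, mul_one] at this
  rw [← this]
  simp [sigmaW]

theorem forestWeight_insert {A : Finset (Fin n × Fin n)} {i m : Fin n} (h : ∀ e ∈ A, e.1 ≠ i) :
    forestWeight W (insert (i, m) A) = W i m * forestWeight W A :=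
  Finset.prod_insert fun hh => h _ hh rfl

theorem lap_mul_apply (M : Matrix (Fin n) (Fin n) ℝ) (i j : Fin n) :
    (lap W * M) i j = ∑ m, W i m * (M i j - M m j) := by
  rw [lap, Matrix.sub_mul, Matrix.sub_apply, Matrix.diagonal_mul, Matrix.mul_apply,
    Finset.sum_mul, ← Finset.sum_sub_distrib]
  simp_rw [mul_sub]

/-- The contributions of all ways of redirecting the arc that leaves `i` cancel in pairs. -/
theorem sum_swap_cancel (w x y : Fin n → ℝ) :
    ∑ m, w m * ∑ l, w l * x l * (x m * (y l - y m)) = 0 := by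
  have h : ∑ m, w m * ∑ l, w l * x l * (x m * (y l - y m)) =
      ∑ m, ∑ l, w m * w l * x m * x l * (y l - y m) := by
    refine Finset.sum_congr rfl fun m _ => ?_
    rw [Finset.mul_sum]
    exact Finset.sum_congr rfl fun l _ => by ring
  have h2 : ∑ m, ∑ l, w m * w l * x m * x l * (y l - y m) =
      -∑ m, ∑ l, w m * w l * x m * x l * (y l - y m) := by
    conv_lhs => rw [Finset.sum_comm]
    rw [← Finset.sum_neg_distrib]
    refine Finset.sum_congr rfl fun m _ => ?_
    rw [← Finset.sum_neg_distrib]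
    exact Finset.sum_congr rfl fun l _ => by ring
  rw [h]
  linarith

/-- The recursion between consecutive forest matrices. -/
theorem forestMatrix_succ_add (hW : ∀ i j, 0 ≤ W i j) (k : ℕ) :
    forestMatrix W (k + 1) + lap W * forestMatrix W k = sigmaW W (k + 1) • 1 := by
  classical
  ext i j
  rw [Matrix.add_apply, lap_mul_apply, Matrix.smul_apply, Matrix.one_apply, smul_eq_mul]
  simp_rw [sigmaW_eq hW, forestMatrix_apply_eq hW, sum_forests_eq i, ← Finset.sum_sub_distrib,
    Finset.mul_sum]
  rw [Finset.sum_comm, ← Finset.sum_add_distrib, Finset.sum_mul]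
  refine Finset.sum_congr rfl fun A hA => ?_
  simp only [Finset.mem_filter, Finset.mem_univ, true_and] at hA
  obtain ⟨hA, hi⟩ := hA
  set x : Fin n → ℝ := fun v => if InTreeRootedAt A v i then 0 else 1 with hx
  set y : Fin n → ℝ := fun v => if InTreeRootedAt A v j then 1 else 0 with hy
  have hcard : ∀ m, (insert (i, m) A).card = A.card + 1 := fun m =>
    Finset.card_insert_of_notMem fun hh => hi _ hh rfl
  have hsum : ∀ v q, ∑ m with ¬ InTreeRootedAt A m i,
      (if (insert (i, m) A).card = q then forestWeight W (insert (i, m) A) else 0) *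
        (if InTreeRootedAt (insert (i, m) A) v j then (1 : ℝ) else 0) =
      (if A.card + 1 = q then forestWeight W A else 0) *
        ∑ m, W i m * x m * ((1 - x v) * y m + x v * y v) := by
    intro v q
    rw [Finset.sum_filter, Finset.mul_sum]
    refine Finset.sum_congr rfl fun m _ => ?_
    by_cases hm : InTreeRootedAt A m i
    · simp [hx, hm]
    · simp only [hcard, forestWeight_insert hi, inTreeRootedAt_insert hA hi hm, hx, hy, hm]
      by_cases hv : InTreeRootedAt A v i <;> by_cases hq : A.card + 1 = q <;>
        simp [hv, hq, mul_comm]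
  have hsigma : ∀ q, ∑ m with ¬ InTreeRootedAt A m i,
      (if (insert (i, m) A).card = q then forestWeight W (insert (i, m) A) else 0) =
      (if A.card + 1 = q then forestWeight W A else 0) * ∑ m, W i m * x m := by
    intro q
    rw [Finset.sum_filter, Finset.mul_sum]
    refine Finset.sum_congr rfl fun m _ => ?_
    by_cases hm : InTreeRootedAt A m i
    · simp [hx, hm]
    · by_cases hq : A.card + 1 = q <;> simp [hx, hm, hcard, forestWeight_insert hi, hq, mul_comm]
  have hroot : InTreeRootedAt A i i := ⟨.refl, hi⟩
  have hxi : x i = 0 := by simp [hx, hroot]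
  have hyi : y i = if i = j then 1 else 0 := by
    have : InTreeRootedAt A i j ↔ i = j :=
      ⟨fun h => hroot.unique hA h, by rintro rfl; exact hroot⟩
    simp [hy, this]
  have hxy : ∀ m, (1 - x m) * y m = (1 - x m) * y i := by
    intro m
    rw [hyi]
    by_cases hm : InTreeRootedAt A m i
    · have : InTreeRootedAt A m j ↔ i = j :=
        ⟨fun h => hm.unique hA h, by rintro rfl; exact hm⟩
      simp [hy, this]
    · simp [hx, hm]
  simp only [hsum, hsigma, add_left_inj, ← hyi, hxi]
  change _ * y i + _ + ∑ m, W i m * (_ * y i + _ - (_ * y m + _)) = _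
  generalize (if A.card = k + 1 then forestWeight W A else 0) = a
  generalize (if A.card = k then forestWeight W A else 0) = b
  generalize (if A.card + 1 = k then forestWeight W A else 0) = e
  have hcancel := sum_swap_cancel (W i) x y
  have hterm : ∀ m, W i m * (b * y i + e * ∑ l, W i l * x l * ((1 - 0) * y l + 0 * y i) -
      (b * y m + e * ∑ l, W i l * x l * ((1 - x m) * y l + x m * y m))) =
      b * (W i m * x m * y i) - b * (W i m * x m * y m) +
        e * (W i m * ∑ l, W i l * x l * (x m * (y l - y m))) := by
    intro m
    have : ∑ l, W i l * x l * (x m * (y l - y m)) =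
        ∑ l, W i l * x l * ((1 - 0) * y l + 0 * y i) -
          ∑ l, W i l * x l * ((1 - x m) * y l + x m * y m) := by
      rw [← Finset.sum_sub_distrib]
      exact Finset.sum_congr rfl fun l _ => by ring
    rw [this]
    linear_combination (-b * W i m) * hxy m
  simp_rw [hterm]
  rw [Finset.sum_add_distrib, Finset.sum_sub_distrib, ← Finset.mul_sum, ← Finset.mul_sum,
    ← Finset.mul_sum, hcancel, ← Finset.sum_mul]
  simp only [sub_zero, one_mul, zero_mul, add_zero]
  ring

/-- Forest matrices act as scalars on the kernel of the Laplacian. -/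
theorem forestMatrix_mul_of_lap_mul_eq_zero (hW : ∀ i j, 0 ≤ W i j)
    {M : Matrix (Fin n) (Fin n) ℝ} (hM : lap W * M = 0) (k : ℕ) :
    forestMatrix W k * M = sigmaW W k • M := by
  induction k with
  | zero =>
    have : forestMatrix W 0 = sigmaW W 0 • 1 := by
      ext i j
      classical
      rw [forestMatrix_apply_eq hW, sigmaW_eq hW, Matrix.smul_apply, smul_eq_mul, Finset.sum_mul]
      refine Finset.sum_congr rfl fun A _ => ?_
      by_cases hA : A = ∅
      · subst hA
        have : InTreeRootedAt (∅ : Finset (Fin n × Fin n)) i j ↔ i = j := by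
          constructor
          · rintro ⟨h, -⟩
            rcases Relation.ReflTransGen.cases_head h with h | ⟨c, hc, -⟩
            · exact h
            · simp at hc
          · rintro rfl
            exact ⟨.refl, by simp⟩
        simp [this, Matrix.one_apply]
      · simp [hA]
    rw [this, Matrix.smul_mul, Matrix.one_mul]
  | succ k ih =>
    rw [eq_sub_of_add_eq (forestMatrix_succ_add hW k), Matrix.sub_mul, Matrix.mul_assoc, ih,
      Matrix.mul_smul, hM, smul_zero, sub_zero, Matrix.smul_mul, Matrix.one_mul]

theorem IsInForest.card_le {A : Finset (Fin n × Fin n)} (hA : IsInForest W A) :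
    A.card ≤ maxForestCard W := by
  classical
  exact Finset.le_sup (f := Finset.card) (by simpa using hA)

theorem sigmaW_maxForestCard_pos : 0 < sigmaW W (maxForestCard W) := by
  classical
  obtain ⟨A, hA, hcard⟩ := Finset.exists_mem_eq_sup
    (Finset.univ.powerset.filter (fun A => IsInForest W A))
    ⟨∅, by simpa using isInForest_empty W⟩ Finset.card
  refine Finset.sum_pos (fun B hB => Finset.prod_pos fun e he => ?_) ⟨A, ?_⟩
  · simp only [Finset.mem_filter] at hB
    exact (hB.2.1.1 e he).2
  · simp only [Finset.mem_filter] at hA ⊢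
    refine ⟨hA.1, hA.2, ?_⟩
    rw [maxForestCard, ← hcard]

theorem lap_mul_forestMatrix_max (hW : ∀ i j, 0 ≤ W i j) :
    lap W * forestMatrix W (maxForestCard W) = 0 := by
  have h := forestMatrix_succ_add hW (maxForestCard W)
  have hlt : ∀ A : Finset (Fin n × Fin n), IsInForest W A → A.card ≠ maxForestCard W + 1 :=
    fun A hA h => by have := hA.card_le; omega
  have h1 : forestMatrix W (maxForestCard W + 1) = 0 := by
    ext i j
    simp only [forestMatrix, Matrix.of_apply, Matrix.zero_apply]
    refine Finset.sum_eq_zero fun A hA => ?_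
    simp only [Finset.mem_filter] at hA
    exact absurd hA.2.2.1 (hlt A hA.2.1)
  have h2 : sigmaW W (maxForestCard W + 1) = 0 := by
    refine Finset.sum_eq_zero fun A hA => ?_
    simp only [Finset.mem_filter] at hA
    exact absurd hA.2.2 (hlt A hA.2.1)
  rwa [h1, h2, zero_add, zero_smul] at h

theorem isIdempotentElem_Jtilde (hW : ∀ i j, 0 ≤ W i j) : IsIdempotentElem (Jtilde W) := by
  have hpos := sigmaW_maxForestCard_pos (W := W)
  rw [IsIdempotentElem, Jtilde, Matrix.smul_mul, Matrix.mul_smul,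
    forestMatrix_mul_of_lap_mul_eq_zero hW (lap_mul_forestMatrix_max hW),
    inv_smul_smul₀ hpos.ne']

open scoped Classical in
/-- A forest has `n - |A|` roots. -/
theorem IsFunctionalForest.card_roots_add_card {A : Finset (Fin n × Fin n)}
    (hA : IsFunctionalForest A) :
    (Finset.univ.filter fun i => InTreeRootedAt A i i).card + A.card = n := by
  have h : (Finset.univ.filter fun i => ¬ InTreeRootedAt A i i) = A.image Prod.fst := by
    ext i
    simp only [Finset.mem_filter, Finset.mem_univ, true_and, InTreeRootedAt,
      Relation.ReflTransGen.refl, Finset.mem_image]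
    push Not
    rfl
  have hcard : (A.image Prod.fst).card = A.card := by
    refine Finset.card_image_of_injOn ?_
    rintro ⟨a, b⟩ hb ⟨a', c⟩ hc (rfl : a = a')
    rw [hA.1 _ _ _ hb hc]
  have := Finset.card_filter_add_card_filter_not (s := (Finset.univ : Finset (Fin n)))
    (fun i => InTreeRootedAt A i i)
  rw [h, hcard] at this
  simpa using this

theorem trace_forestMatrix (hW : ∀ i j, 0 ≤ W i j) (k : ℕ) :
    (forestMatrix W k).trace = ((n : ℝ) - k) * sigmaW W k := by
  classical
  simp only [Matrix.trace, Matrix.diag_apply, forestMatrix_apply_eq hW, sigmaW_eq hW]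
  rw [Finset.sum_comm, Finset.mul_sum]
  refine Finset.sum_congr rfl fun A hA => ?_
  simp only [Finset.mem_filter, Finset.mem_univ, true_and] at hA
  rw [← Finset.mul_sum, Finset.sum_boole, mul_comm]
  by_cases hk : A.card = k
  · have := hA.card_roots_add_card
    rw [hk] at this
    have hcast := congrArg (Nat.cast : ℕ → ℝ) this
    push_cast at hcast
    rw [eq_sub_of_add_eq hcast]
  · simp [hk]

theorem maxForestCard_le : maxForestCard W ≤ n := by
  classical
  refine Finset.sup_le fun A hA => ?_
  simp only [Finset.mem_filter] at hA
  have := (isInForest_iff.1 hA.2).1.card_roots_add_card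
  omega

theorem trace_Jtilde (hW : ∀ i j, 0 ≤ W i j) : (Jtilde W).trace = forestDim W := by
  have hpos := sigmaW_maxForestCard_pos (W := W)
  rw [Jtilde, Matrix.trace_smul, trace_forestMatrix hW, forestDim, Nat.cast_sub maxForestCard_le,
    smul_eq_mul]
  field_simp

end Weights

section Idempotent

variable {K ι : Type*} [Field K] [Fintype ι] [DecidableEq ι] {M : Matrix ι ι K}

theorem isProj_range_toLin'_of_isIdempotentElem (hM : IsIdempotentElem M) :
    LinearMap.IsProj (LinearMap.range M.toLin') M.toLin' := by
  refine ⟨fun x => ⟨x, rfl⟩, ?_⟩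
  rintro _ ⟨x, rfl⟩
  rw [← LinearMap.comp_apply, ← Matrix.toLin'_mul, hM.eq]

theorem rank_eq_trace_of_isIdempotentElem (hM : IsIdempotentElem M) : (M.rank : K) = M.trace := by
  rw [← Matrix.trace_toLin'_eq, (isProj_range_toLin'_of_isIdempotentElem hM).trace]
  rfl

theorem charpoly_of_isIdempotentElem (hM : IsIdempotentElem M) :
    M.charpoly = (X - 1) ^ M.rank * X ^ (Fintype.card ι - M.rank) := by
  have h := isProj_range_toLin'_of_isIdempotentElem hM
  have hker : Module.finrank K (LinearMap.ker M.toLin') = Fintype.card ι - M.rank := by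
    have := LinearMap.finrank_range_add_finrank_ker M.toLin'
    rw [Module.finrank_fintype_fun_eq_card] at this
    have h2 : M.rank = Module.finrank K (LinearMap.range M.toLin') := rfl
    omega
  rw [← Matrix.charpoly_toLin', h.eq_conj_prodMap, LinearEquiv.charpoly_conj,
    LinearMap.charpoly_prodMap, LinearMap.charpoly_zero, hker]
  congr 1
  exact LinearMap.charpoly_one

end Idempotent

/-- `rank J̃ = tr J̃ = d`, the eigenvalue `1` of `J̃` has multiplicity `d`, and
the eigenvalue `0` of `J̃` has multiplicity `n − d`. -/
theorem Jtilde_rank_trace {n : ℕ} (W : Matrix (Fin n) (Fin n) ℝ)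
    (hn : 1 < n) (hW : ∀ i j, 0 ≤ W i j) (hdiag : ∀ i, W i i = 0) :
    (Jtilde W).rank = forestDim W ∧
    (Jtilde W).trace = (forestDim W : ℝ) ∧
    (Jtilde W).charpoly.rootMultiplicity 1 = forestDim W ∧
    (Jtilde W).charpoly.rootMultiplicity 0 = n - forestDim W := by
  have hidem := isIdempotentElem_Jtilde hW
  have htr := trace_Jtilde hW
  have hrank : (Jtilde W).rank = forestDim W := by
    have := rank_eq_trace_of_isIdempotentElem hidem
    rw [htr] at this
    exact_mod_cast this
  have hne : ((X - 1 : ℝ[X]) ^ forestDim W * X ^ (n - forestDim W)) ≠ 0 :=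
    mul_ne_zero (pow_ne_zero _ (by simpa using X_sub_C_ne_zero (1 : ℝ))) (pow_ne_zero _ X_ne_zero)
  refine ⟨hrank, htr, ?_, ?_⟩
  all_goals
    rw [charpoly_of_isIdempotentElem hidem, hrank, Fintype.card_fin, rootMultiplicity_mul hne]
  · have h1 := rootMultiplicity_X_sub_C_pow (1 : ℝ) (forestDim W)
    rw [C_1] at h1
    rw [h1, rootMultiplicity_eq_zero (by simp [IsRoot]), add_zero]
  · have h0 := rootMultiplicity_X_sub_C_pow (0 : ℝ) (n - forestDim W)
    rw [C_0, sub_zero] at h0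
    rw [h0, rootMultiplicity_eq_zero (by simp [IsRoot]), zero_add]
end
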